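/- arXiv:1412.4461 — 2 statements merged into one kernel-verified Lean document; each statement's English description precedes it below -/
import Mathlib

section
/- Let a ⊆ E(ℝⁿ) be the ideal generated by finitely many smooth functions f₁,…,f_l, and suppose a contains an element f₀ such that for every compact K ⊆ ℝⁿ there exist a constant c > 0 and a positive integer m with |f₀(x)| ≥ c · dist(x, Z(a))^m for all x in some open neighborhood of K. Then the sum of squares f = f₁² + ⋯ + f_l² has the same property: for every compact K ⊆ ℝⁿ there exist a constant c' > 0 and a positive integer m' with f(x) ≥ c' · dist(x, Z(a))^(m') for all x in some open neighborhood of K. -/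
/-- The ring `E(ℝⁿ)` of real-valued smooth (`C^∞`) functions on `ℝⁿ`,
as an `ℝ`-subalgebra of all functions `ℝⁿ → ℝ`. -/
def SmoothFns (n : ℕ) : Subalgebra ℝ ((Fin n → ℝ) → ℝ) where
  carrier := {f | ContDiff ℝ (⊤ : ℕ∞) f}
  mul_mem' := fun {a b} (hf : ContDiff ℝ (⊤ : ℕ∞) a) (hg : ContDiff ℝ (⊤ : ℕ∞) b) =>
    show ContDiff ℝ (⊤ : ℕ∞) (a * b) from hf.mul hg
  add_mem' := fun {a b} (hf : ContDiff ℝ (⊤ : ℕ∞) a) (hg : ContDiff ℝ (⊤ : ℕ∞) b) =>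
    show ContDiff ℝ (⊤ : ℕ∞) (a + b) from hf.add hg
  algebraMap_mem' := fun _r => show ContDiff ℝ (⊤ : ℕ∞) _ from contDiff_const

theorem SmoothFns.sum_mul_val_apply {n l : ℕ} (G F : Fin l → SmoothFns n) (x : Fin n → ℝ) :
    (∑ i, G i * F i).1 x = ∑ i, (G i).1 x * (F i).1 x := by
  simp

theorem SmoothFns.continuous_val {n : ℕ} (f : SmoothFns n) : Continuous f.1 :=
  ContDiff.continuous (n := ((⊤ : ℕ∞) : WithTop ℕ∞)) f.2

/-- Remark: if the ideal `a = (f₁, …, f_l)` contains an element `f₀` satisfying a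
Łojasiewicz inequality `|f₀(x)| ≥ c·dist(x, Z(a))^m` near every compact set, then the
sum of squares of the generators `f = f₁² + ⋯ + f_l²` satisfies one as well. -/
theorem sum_sq_generators_lojasiewicz (n l : ℕ) (F : Fin l → SmoothFns n)
    (a : Ideal (SmoothFns n)) (ha : a = Ideal.span (Set.range F))
    (f₀ : SmoothFns n) (hf₀ : f₀ ∈ a)
    (hLoj : ∀ K : Set (Fin n → ℝ), IsCompact K →
      ∃ c : ℝ, 0 < c ∧ ∃ m : ℕ, 1 ≤ m ∧ ∃ V : Set (Fin n → ℝ), IsOpen V ∧ K ⊆ V ∧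
        ∀ x ∈ V, c * Metric.infDist x {y | ∀ h ∈ a, h.1 y = 0} ^ m ≤ |f₀.1 x|) :
    ∀ K : Set (Fin n → ℝ), IsCompact K →
      ∃ c' : ℝ, 0 < c' ∧ ∃ m' : ℕ, 1 ≤ m' ∧ ∃ V : Set (Fin n → ℝ), IsOpen V ∧ K ⊆ V ∧
        ∀ x ∈ V, c' * Metric.infDist x {y | ∀ h ∈ a, h.1 y = 0} ^ m'
          ≤ (∑ i, F i * F i).1 x := by
  intro K hK
  obtain ⟨c, hc, m, hm, V, hV, hKV, hle⟩ := hLoj K hK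
  subst ha
  obtain ⟨G, rfl⟩ := Ideal.mem_span_range_iff_exists_fun.1 hf₀
  set g := (∑ i, G i * G i : SmoothFns n)
  obtain ⟨M, hM⟩ := hK.bddAbove_image (SmoothFns.continuous_val g).continuousOn
  have hpos : 0 < |M| + 1 := by positivity
  refine ⟨c ^ 2 / (|M| + 1), by positivity, m * 2, by omega, V ∩ g.1 ⁻¹' Set.Iio (|M| + 1),
    hV.inter (isOpen_Iio.preimage (SmoothFns.continuous_val g)), fun x hx => ⟨hKV hx, ?_⟩, ?_⟩
  · have h : g.1 x ≤ M := hM ⟨x, hx, rfl⟩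
    exact (h.trans (le_abs_self M)).trans_lt (lt_add_one _)
  rintro x ⟨hxV, hxg : g.1 x < |M| + 1⟩
  have hF : 0 ≤ (∑ i, F i * F i).1 x := by
    rw [SmoothFns.sum_mul_val_apply]
    exact Finset.sum_nonneg fun i _ => mul_self_nonneg ((F i).1 x)
  have hcs : (∑ i, G i * F i).1 x ^ 2 ≤ g.1 x * (∑ i, F i * F i).1 x := by
    simp only [g, SmoothFns.sum_mul_val_apply, ← pow_two (_ : ℝ)]
    exact Finset.sum_mul_sq_le_sq_mul_sq Finset.univ (fun i => (G i).1 x) fun i => (F i).1 x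
  have hsq := pow_le_pow_left₀ (mul_nonneg hc.le (pow_nonneg Metric.infDist_nonneg m))
    (hle x hxV) 2
  rw [sq_abs, mul_pow, ← pow_mul] at hsq
  rw [div_mul_eq_mul_div, div_le_iff₀ hpos, mul_comm _ (|M| + 1)]
  exact hsq.trans (hcs.trans (mul_le_mul_of_nonneg_right hxg.le hF))
end

section
/- Let a be an ideal of E(ℝⁿ) (not necessarily finitely generated). Assume that for every compact set K ⊆ ℝⁿ there exist finitely many elements f₁,…,f_l ∈ a and an open set U ⊇ K such that Z(a) ∩ U = Z(f₁,…,f_l) ∩ U, and such that f = f₁² + ⋯ + f_l² satisfies a Łojasiewicz inequality on U: for every compact K' ⊆ U there exist c > 0, a positive integer m, and an open set V with K' ⊆ V ⊆ U such that f(x) ≥ c · dist(x, Z(a) ∩ U)^m for all x ∈ V. Then I(Z(a)) = (√[Ł]a)_K, i.e. a smooth function g vanishes identically on Z(a) if and only if for every compact K ⊆ ℝⁿ there exist f' ∈ a and an integer m ≥ 1 with f'(x) − g(x)^(2m) ≥ 0 for all x ∈ K. -/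
theorem SmoothFns.contDiff {n : ℕ} (g : SmoothFns n) : ContDiff ℝ (⊤ : ℕ∞) g.1 := g.2

theorem SmoothFns.sum_sq_apply {n l : ℕ} (F : Fin l → SmoothFns n) (x : Fin n → ℝ) :
    (∑ i, F i * F i).1 x = ∑ i, (F i).1 x * (F i).1 x := by
  change (SmoothFns n).val (∑ i, F i * F i) x = _
  simp

/-- A `C¹` function vanishing on a nonempty set `S` is bounded, on each compact set, by a multiple
of the distance to `S`. -/
theorem exists_abs_le_mul_infDist_of_contDiff {E : Type*} [NormedAddCommGroup E] [NormedSpace ℝ E]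
    [ProperSpace E] {g : E → ℝ} (hg : ContDiff ℝ 1 g) {S K : Set E} (hS : S.Nonempty)
    (hgS : ∀ z ∈ S, g z = 0) (hK : IsCompact K) :
    ∃ L : ℝ, 0 < L ∧ ∀ x ∈ K, |g x| ≤ L * Metric.infDist x S := by
  obtain ⟨z₀, hz₀⟩ := hS
  obtain ⟨R, hR⟩ := hK.isBounded.subset_closedBall z₀
  obtain ⟨C, hC⟩ := hg.contDiffOn.exists_lipschitzOnWith one_ne_zero
    (convex_closedBall z₀ (2 * R)) (isCompact_closedBall z₀ (2 * R))
  have hpos : (0 : ℝ) < C + 1 := by positivity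
  refine ⟨C + 1, hpos, fun x hx => ?_⟩
  have hxR : dist x z₀ ≤ R := hR hx
  have hR0 : 0 ≤ R := dist_nonneg.trans hxR
  have near : ∀ z ∈ S, dist z z₀ ≤ 2 * R → |g x| ≤ (C + 1) * dist x z := by
    intro z hz hzR
    have h := hC.dist_le_mul x (by simpa using hxR.trans (by linarith)) z (by simpa using hzR)
    rw [hgS z hz, Real.dist_eq, sub_zero] at h
    nlinarith [dist_nonneg (x := x) (y := z)]
  rw [← div_le_iff₀' hpos, Metric.le_infDist ⟨z₀, hz₀⟩]
  intro z hz
  rw [div_le_iff₀' hpos]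
  rcases le_or_gt (dist z z₀) (2 * R) with h | h
  · exact near z hz h
  · refine (near z₀ hz₀ (by simpa using hR0)).trans ?_
    have := dist_triangle z x z₀
    rw [dist_comm z x] at this
    gcongr
    linarith

/-- Main Theorem, part (ii) (analytic content): let `a` be an ideal of `E(ℝⁿ)` such
that near every compact set the zero set `Z(a)` is cut out by finitely many elements
`f₁, …, f_l ∈ a` whose sum of squares satisfies a Łojasiewicz inequality on a
neighborhood `U`. Then `I(Z(a)) = (√[Ł]a)_K`, the Łojasiewicz radical computed on all
compact subsets of `ℝⁿ`. -/
theorem vanishing_ideal_eq_compact_LRadical (n : ℕ) (a : Ideal (SmoothFns n))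
    (hyp : ∀ K : Set (Fin n → ℝ), IsCompact K →
      ∃ l : ℕ, ∃ F : Fin l → SmoothFns n, (∀ i, F i ∈ a) ∧
        ∃ U : Set (Fin n → ℝ), IsOpen U ∧ K ⊆ U ∧
          {x | ∀ h ∈ a, h.1 x = 0} ∩ U = {x | ∀ i, (F i).1 x = 0} ∩ U ∧
          (∀ K' : Set (Fin n → ℝ), K' ⊆ U → IsCompact K' →
            ∃ c : ℝ, 0 < c ∧ ∃ m : ℕ, 1 ≤ m ∧ ∃ V : Set (Fin n → ℝ),
              IsOpen V ∧ K' ⊆ V ∧ V ⊆ U ∧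
              ∀ x ∈ V, c * Metric.infDist x ({x | ∀ h ∈ a, h.1 x = 0} ∩ U) ^ m
                ≤ (∑ i, F i * F i).1 x))
    (g : SmoothFns n) :
    (∀ x ∈ {x : Fin n → ℝ | ∀ h ∈ a, h.1 x = 0}, g.1 x = 0) ↔
    (∀ K : Set (Fin n → ℝ), IsCompact K →
      ∃ f' ∈ a, ∃ m : ℕ, 1 ≤ m ∧ ∀ x ∈ K, f'.1 x - g.1 x ^ (2 * m) ≥ 0) := by
  constructor
  · intro hg K hK
    obtain ⟨l, F, hF, U, -, hKU, hZ, hL⟩ := hyp K hK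
    have hfa : ∑ i, F i * F i ∈ a := Ideal.sum_mem _ fun i _ => a.mul_mem_left _ (hF i)
    suffices ∃ (C : ℝ) (m : ℕ), 1 ≤ m ∧
        ∀ x ∈ K, g.1 x ^ (2 * m) ≤ C * (∑ i, F i * F i).1 x by
      obtain ⟨C, m, hm, h⟩ := this
      refine ⟨algebraMap ℝ (SmoothFns n) C * ∑ i, F i * F i, a.mul_mem_left _ hfa, m, hm,
        fun x hx => ?_⟩
      exact sub_nonneg.2 (h x hx)
    obtain ⟨M, hM⟩ := hK.exists_bound_of_continuousOn (SmoothFns.contDiff g).continuous.continuousOn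
    simp only [Real.norm_eq_abs] at hM
    rcases Set.eq_empty_or_nonempty ({x | ∀ h ∈ a, h.1 x = 0} ∩ U) with hS | hS
    · have hpos : ∀ x ∈ K, 0 < (∑ i, F i * F i).1 x := by
        intro x hx
        rw [SmoothFns.sum_sq_apply]
        refine lt_of_le_of_ne (Finset.sum_nonneg fun i _ => mul_self_nonneg _) fun h0 => ?_
        rw [eq_comm, Finset.sum_eq_zero_iff_of_nonneg fun i _ => mul_self_nonneg _] at h0
        have hxS : x ∈ {x | ∀ i, (F i).1 x = 0} ∩ U :=
          ⟨fun i => mul_self_eq_zero.1 (h0 i (Finset.mem_univ i)), hKU hx⟩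
        rw [← hZ, hS] at hxS
        exact hxS
      obtain ⟨C, hC⟩ := hK.exists_bound_of_continuousOn
        (f := fun x => g.1 x ^ (2 * 1) / (∑ i, F i * F i).1 x)
        (((SmoothFns.contDiff g).continuous.pow _).continuousOn.div
          (SmoothFns.contDiff _).continuous.continuousOn fun x hx => (hpos x hx).ne')
      refine ⟨C, 1, le_rfl, fun x hx => ?_⟩
      rw [← div_le_iff₀ (hpos x hx)]
      exact (le_abs_self _).trans (hC x hx)
    · obtain ⟨c, hc, m, hm, V, -, hKV, -, hV⟩ := hL K hKU hK
      obtain ⟨L, hL0, hgL⟩ := exists_abs_le_mul_infDist_of_contDiff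
        ((SmoothFns.contDiff g).of_le (by exact_mod_cast le_top)) hS (fun z hz => hg z hz.1) hK
      refine ⟨(M * L) ^ m / c, m, hm, fun x hx => ?_⟩
      have hM0 : 0 ≤ M := (abs_nonneg _).trans (hM x hx)
      set d := Metric.infDist x ({x | ∀ h ∈ a, h.1 x = 0} ∩ U)
      calc g.1 x ^ (2 * m) = (|g.1 x| * |g.1 x|) ^ m := by rw [abs_mul_abs_self, pow_mul, sq]
        _ ≤ (M * (L * d)) ^ m := by
          gcongr
          exacts [hM x hx, hgL x hx]
        _ = (M * L) ^ m / c * (c * d ^ m) := by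
          rw [← mul_assoc, mul_pow _ d]
          field_simp
        _ ≤ (M * L) ^ m / c * (∑ i, F i * F i).1 x := by
          gcongr
          exact hV x (hKV hx)
  · intro h x hx
    obtain ⟨f, hf, m, hm, hfg⟩ := h {x} isCompact_singleton
    have h1 := hfg x rfl
    rw [hx f hf, zero_sub, ge_iff_le, neg_nonneg] at h1
    exact eq_zero_of_pow_eq_zero
      (le_antisymm h1 ((even_two_mul m).pow_nonneg _))
end
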